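/- Let T be a ℂ-linear map from the space of holomorphic functions on 𝔸 to itself, continuous with respect to the topology of uniform convergence on compact subsets of 𝔸, such that for every holomorphic f on 𝔸 and every integer n ≥ 1, sup{|（Tf)(z)| : z ∈ Kₙ} = sup{|f(z)| : z ∈ Kₙ}. Then there exist constants α, β ∈ ℂ with |α| = |β| = 1 such that either (Tf)(z) = α·f(β·z) for all holomorphic f on 𝔸 and all z ∈ 𝔸, or (Tf)(z) = α·f(β/z) for all holomorphic f on 𝔸 and all z ∈ 𝔸. -/

import Mathlib

open Complex Set Filter Topology

/-- The open annulus `{z : 1/R < |z| < R}`, symmetric with respect to the unit circle. -/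
def ann (R : ℝ) : Set ℂ := {z : ℂ | 1 / R < ‖z‖ ∧ ‖z‖ < R}

/-- The compact sets `Kₙ = {z : R^(1/n − 1) ≤ |z| ≤ R^(1 − 1/n)}` exhausting the annulus. -/
def annK (R : ℝ) (n : ℕ) : Set ℂ :=
  {z : ℂ | R ^ ((1 : ℝ) / n - 1) ≤ ‖z‖ ∧ ‖z‖ ≤ R ^ (1 - (1 : ℝ) / n)}

open ComplexConjugate

lemma isOpen_ann (R : ℝ) : IsOpen (ann R) :=
  (isOpen_lt continuous_const continuous_norm).inter (isOpen_lt continuous_norm continuous_const)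

lemma isCompact_annK (R : ℝ) (n : ℕ) : IsCompact (annK R n) := by
  refine Metric.isCompact_of_isClosed_isBounded ?_ ?_
  · exact (isClosed_le continuous_const continuous_norm).inter
      (isClosed_le continuous_norm continuous_const)
  · exact (Metric.isBounded_closedBall (x := (0 : ℂ)) (r := R ^ (1 - (1 : ℝ) / n))).subset
      fun z hz => by simpa using hz.2

lemma annK_subset_ann {R : ℝ} (hR : 1 < R) {n : ℕ} (hn : 1 ≤ n) : annK R n ⊆ ann R := by
  have hn' : (0 : ℝ) < 1 / n := by positivity
  intro z hz
  constructor
  · calc 1 / R = R ^ (-1 : ℝ) := by rw [Real.rpow_neg_one, one_div]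
      _ < R ^ ((1 : ℝ) / n - 1) := Real.rpow_lt_rpow_of_exponent_lt hR (by linarith)
      _ ≤ ‖z‖ := hz.1
  · calc ‖z‖ ≤ R ^ (1 - (1 : ℝ) / n) := hz.2
      _ < R ^ (1 : ℝ) := Real.rpow_lt_rpow_of_exponent_lt hR (by linarith)
      _ = R := Real.rpow_one R

lemma mem_annK_one {R : ℝ} {z : ℂ} : z ∈ annK R 1 ↔ ‖z‖ = 1 := by
  simp [annK, le_antisymm_iff, and_comm]

lemma mem_annK_iff {R : ℝ} (hR : 1 < R) {n : ℕ} {z : ℂ} :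
    z ∈ annK R n ↔ (R ^ (1 - (1 : ℝ) / n))⁻¹ ≤ ‖z‖ ∧ ‖z‖ ≤ R ^ (1 - (1 : ℝ) / n) := by
  rw [← Real.rpow_neg (by linarith), neg_sub]
  rfl

lemma mem_ann_of_norm_eq_one {R : ℝ} (hR : 1 < R) {z : ℂ} (hz : ‖z‖ = 1) : z ∈ ann R :=
  annK_subset_ann hR le_rfl (mem_annK_one.2 hz)

lemma ne_zero_of_mem_ann {R : ℝ} (hR : 1 < R) {z : ℂ} (hz : z ∈ ann R) : z ≠ 0 :=
  norm_pos_iff.1 ((by positivity : 0 < 1 / R).trans hz.1)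

lemma div_mem_ann {R : ℝ} (hR : 1 < R) {β z : ℂ} (hβ : ‖β‖ = 1) (hz : z ∈ ann R) :
    β / z ∈ ann R := by
  have hz0 : 0 < ‖z‖ := norm_pos_iff.2 (ne_zero_of_mem_ann hR hz)
  change 1 / R < ‖β / z‖ ∧ ‖β / z‖ < R
  rw [norm_div, hβ]
  exact ⟨one_div_lt_one_div_of_lt hz0 hz.2, (one_div_lt hz0 (by linarith)).2 hz.1⟩

lemma isPreconnected_ann {R : ℝ} (hR : 1 < R) : IsPreconnected (ann R) := by
  have hR0 : 0 < R := by linarith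
  have himage : ann R = exp '' (re ⁻¹' Ioo (-Real.log R) (Real.log R)) := by
    ext z
    constructor
    · intro hz
      have hz0 := ne_zero_of_mem_ann hR hz
      refine ⟨log z, ⟨?_, ?_⟩, exp_log hz0⟩
      · rw [log_re, ← Real.log_inv, ← one_div]
        exact Real.log_lt_log (by positivity) hz.1
      · rw [log_re]
        exact Real.log_lt_log (norm_pos_iff.2 hz0) hz.2
    · rintro ⟨w, hw, rfl⟩
      constructor
      · rw [norm_exp, one_div, ← Real.exp_log hR0, ← Real.exp_neg]
        exact Real.exp_lt_exp.2 hw.1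
      · rw [norm_exp]
        exact (Real.lt_log_iff_exp_lt hR0).1 hw.2
  rw [himage]
  refine IsPreconnected.image ?_ _ continuous_exp.continuousOn
  exact ((convex_Ioo _ _).linear_preimage reLm).isPreconnected

/-- Holomorphic functions on the annulus which agree at infinitely many points of the unit circle
are equal. -/
lemma eqOn_ann_of_infinite {R : ℝ} (hR : 1 < R) {f g : ℂ → ℂ}
    (hf : DifferentiableOn ℂ f (ann R)) (hg : DifferentiableOn ℂ g (ann R))
    (h : {z : ℂ | ‖z‖ = 1 ∧ f z = g z}.Infinite) : EqOn f g (ann R) := by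
  obtain ⟨z₀, hz₀, hacc⟩ := h.exists_accPt_of_subset_isCompact (isCompact_sphere (0 : ℂ) 1)
    fun z hz => by simpa using hz.1
  refine (hf.analyticOnNhd (isOpen_ann R)).eqOn_of_preconnected_of_frequently_eq
    (hg.analyticOnNhd (isOpen_ann R)) (isPreconnected_ann hR)
    (mem_ann_of_norm_eq_one hR (by simpa using hz₀)) ?_
  exact (accPt_iff_frequently_nhdsNE.1 hacc).mono fun z hz => hz.2

lemma infinite_unitCircle : {z : ℂ | ‖z‖ = 1}.Infinite := by
  have h : (Metric.sphere (0 : ℂ) 1).Infinite := by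
    refine (isPreconnected_sphere ?_ 0 1).infinite_of_nontrivial ⟨1, by simp, -1, by simp, ?_⟩
    · rw [Complex.rank_real_complex]; norm_num
    · norm_num
  exact h.mono fun z hz => by simpa using hz

lemma eqOn_ann_of_eq_unitCircle {R : ℝ} (hR : 1 < R) {f g : ℂ → ℂ}
    (hf : DifferentiableOn ℂ f (ann R)) (hg : DifferentiableOn ℂ g (ann R))
    (h : ∀ z : ℂ, ‖z‖ = 1 → f z = g z) : EqOn f g (ann R) :=
  eqOn_ann_of_infinite hR hf hg (infinite_unitCircle.mono fun z hz => ⟨hz, h z hz⟩)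

/-- Strong maximum principle on the annulus. -/
lemma eqOn_const_of_isLocalMax_norm {R : ℝ} (hR : 1 < R) {f : ℂ → ℂ} {c : ℂ}
    (hf : DifferentiableOn ℂ f (ann R)) (hc : c ∈ ann R) (hmax : IsLocalMax (norm ∘ f) c) :
    ∀ z ∈ ann R, f z = f c := by
  have hev : ∀ᶠ z in 𝓝 c, f z = f c := by
    refine eventually_eq_of_isLocalMax_norm ?_ hmax
    filter_upwards [(isOpen_ann R).mem_nhds hc] with z hz
    exact hf.differentiableAt ((isOpen_ann R).mem_nhds hz)
  exact (hf.analyticOnNhd (isOpen_ann R)).eqOn_of_preconnected_of_eventuallyEq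
    analyticOnNhd_const (isPreconnected_ann hR) hc hev

lemma eqOn_const_of_norm_le_one {R a b : ℝ} (hR : 1 < R) (ha : 1 / R < a) (hb : b < R)
    {f : ℂ → ℂ} {c : ℂ} (hf : DifferentiableOn ℂ f (ann R))
    (hfa : ∀ z, ‖z‖ = a → ‖f z‖ ≤ 1) (hfb : ∀ z, ‖z‖ = b → ‖f z‖ ≤ 1)
    (hac : a < ‖c‖) (hcb : ‖c‖ < b) (hc : 1 ≤ ‖f c‖) :
    ∀ z ∈ ann R, f z = f c := by
  set U : Set ℂ := {z | a < ‖z‖ ∧ ‖z‖ < b}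
  have hU : IsOpen U :=
    (isOpen_lt continuous_const continuous_norm).inter (isOpen_lt continuous_norm continuous_const)
  have hcl : closure U ⊆ {z | a ≤ ‖z‖ ∧ ‖z‖ ≤ b} :=
    closure_minimal (fun z hz => ⟨hz.1.le, hz.2.le⟩)
      ((isClosed_le continuous_const continuous_norm).inter
        (isClosed_le continuous_norm continuous_const))
  have hle : ∀ z ∈ U, ‖f z‖ ≤ 1 := by
    intro z hz
    refine norm_le_of_forall_mem_frontier_norm_le (U := U) ?_ ?_ ?_ (subset_closure hz)
    · exact (Metric.isBounded_closedBall (x := (0 : ℂ)) (r := b)).subset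
        fun z hz => by simpa using hz.2.le
    · exact (hf.mono fun z hz =>
        ⟨ha.trans_le (hcl hz).1, (hcl hz).2.trans_lt hb⟩).diffContOnCl
    · intro w hw
      rw [hU.frontier_eq] at hw
      obtain ⟨h1, h2⟩ := hcl hw.1
      rcases h1.eq_or_lt with h | h
      · exact hfa w h.symm
      · rcases h2.eq_or_lt with h' | h'
        · exact hfb w h'
        · exact absurd ⟨h, h'⟩ hw.2
  refine eqOn_const_of_isLocalMax_norm hR hf ⟨ha.trans hac, hcb.trans hb⟩ ?_
  filter_upwards [hU.mem_nhds ⟨hac, hcb⟩] with z hz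
  exact (hle z hz).trans hc

lemma eq_one_of_two_le_norm_one_add {v : ℂ} (hv : ‖v‖ ≤ 1) (h : 2 ≤ ‖1 + v‖) : v = 1 := by
  have h1 : v.re * v.re + v.im * v.im ≤ 1 := by
    rw [← normSq_apply, normSq_eq_norm_sq]
    nlinarith [norm_nonneg v]
  have h2 : 4 ≤ (1 + v.re) * (1 + v.re) + v.im * v.im := by
    have := normSq_apply (1 + v)
    rw [normSq_eq_norm_sq] at this
    simp only [add_re, one_re, add_im, one_im, zero_add] at this
    nlinarith
  have hre : v.re = 1 := by nlinarith
  have him : v.im = 0 := by nlinarith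
  exact Complex.ext hre him

lemma conj_mul_self_of_norm_eq_one {ζ : ℂ} (hζ : ‖ζ‖ = 1) : conj ζ * ζ = 1 := by
  rw [mul_comm, mul_conj, normSq_eq_norm_sq, hζ]
  norm_num

lemma eq_of_conj_mul_eq_one {ζ v : ℂ} (hζ : ‖ζ‖ = 1) (h : conj ζ * v = 1) : v = ζ := by
  calc v = conj ζ * ζ * v := by rw [conj_mul_self_of_norm_eq_one hζ, one_mul]
    _ = ζ := by rw [mul_right_comm, h, one_mul]

/-- If two functions have equal suprema of norms on a compact set, each value of one is dominated in
norm by a value of the other. -/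
lemma exists_norm_le_of_sSup_eq {K : Set ℂ} (hK : IsCompact K) {f g : ℂ → ℂ}
    (hf : ContinuousOn f K) (hg : ContinuousOn g K)
    (h : sSup ((fun z => ‖f z‖) '' K) = sSup ((fun z => ‖g z‖) '' K)) {z : ℂ} (hz : z ∈ K) :
    ∃ w ∈ K, ‖f z‖ ≤ ‖g w‖ := by
  obtain ⟨w, hw, hsup⟩ := hK.exists_sSup_image_eq ⟨z, hz⟩ hg.norm
  refine ⟨w, hw, ?_⟩
  rw [← hsup, ← h]
  exact le_csSup (hK.bddAbove_image hf.norm) (mem_image_of_mem _ hz)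

/-- A function of modulus one at infinitely many points of the unit circle is unimodular on it. -/
lemma norm_eq_one_of_infinite {R : ℝ} (hR : 1 < R) {φ : ℂ → ℂ}
    (hφ : DifferentiableOn ℂ φ (ann R)) (h : {w : ℂ | ‖w‖ = 1 ∧ ‖φ w‖ = 1}.Infinite)
    {w : ℂ} (hw : ‖w‖ = 1) : ‖φ w‖ = 1 := by
  have hrefl : ∀ z : ℂ, ‖z‖ = 1 → conj z⁻¹ = z := by
    intro z hz
    rw [inv_def, normSq_eq_norm_sq, hz]
    simp
  have hmaps : ∀ z ∈ ann R, conj z⁻¹ ∈ ann R := by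
    intro z hz
    simpa [ann] using div_mem_ann hR norm_one hz
  have hstar : DifferentiableOn ℂ (fun z => conj (φ (conj z⁻¹))) (ann R) := by
    intro z hz
    have h1 : DifferentiableAt ℂ φ (conj z⁻¹) :=
      hφ.differentiableAt ((isOpen_ann R).mem_nhds (hmaps z hz))
    have h2 := h1.conj_conj
    rw [conj_conj] at h2
    exact (h2.comp z (differentiableAt_inv (ne_zero_of_mem_ann hR hz))).differentiableWithinAt
  have hsq : ∀ z : ℂ, ‖z‖ = 1 → φ z * conj (φ (conj z⁻¹)) = ((‖φ z‖ ^ 2 : ℝ) : ℂ) := by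
    intro z hz
    rw [hrefl z hz, mul_conj, normSq_eq_norm_sq]
  have heq := eqOn_ann_of_infinite hR (hφ.mul hstar) (differentiableOn_const (1 : ℂ))
    (h.mono fun z hz => ⟨hz.1, (hsq z hz.1).trans (by rw [hz.2]; norm_num)⟩)
  have h1 : ((‖φ w‖ ^ 2 : ℝ) : ℂ) = 1 :=
    (hsq w hw).symm.trans (heq (mem_ann_of_norm_eq_one hR hw))
  have h2 : ‖φ w‖ ^ 2 = 1 := by exact_mod_cast h1
  exact (pow_eq_one_iff_of_nonneg (norm_nonneg _) two_ne_zero).1 h2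

/-- A holomorphic function with `‖φ‖_{∞,n} = ‖z‖_{∞,n}` for `n = 2, 3` which is unimodular on the
unit circle is a rotation, possibly composed with the inversion. -/
lemma exists_eq_mul_or_eq_div {R : ℝ} (hR : 1 < R) {φ : ℂ → ℂ}
    (hφ : DifferentiableOn ℂ φ (ann R)) (h1 : ∀ z : ℂ, ‖z‖ = 1 → ‖φ z‖ = 1)
    (h2 : ∃ c ∈ annK R 2, R ^ (1 - (1 : ℝ) / (2 : ℕ)) ≤ ‖φ c‖)
    (h3 : ∀ z ∈ annK R 3, ‖φ z‖ ≤ R ^ (1 - (1 : ℝ) / (3 : ℕ))) :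
    ∃ β : ℂ, ‖β‖ = 1 ∧ ((∀ z ∈ ann R, φ z = β * z) ∨ (∀ z ∈ ann R, φ z = β / z)) := by
  have hR0 : 0 < R := by linarith
  obtain ⟨c, hcK, hc⟩ := h2
  have hcA : c ∈ ann R := annK_subset_ann hR (by norm_num) hcK
  have hc0 : c ≠ 0 := ne_zero_of_mem_ann hR hcA
  have hcpos : 0 < ‖c‖ := norm_pos_iff.2 hc0
  rw [mem_annK_iff hR] at hcK
  set r := R ^ (1 - (1 : ℝ) / (2 : ℕ))
  set s := R ^ (1 - (1 : ℝ) / (3 : ℕ))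
  have hr1 : 1 < r := Real.one_lt_rpow hR (by norm_num)
  have hrs : r < s := Real.rpow_lt_rpow_of_exponent_lt hR (by norm_num)
  have hsR : s < R := by
    conv_rhs => rw [← Real.rpow_one R]
    exact Real.rpow_lt_rpow_of_exponent_lt hR (by norm_num)
  have hs0 : 0 < s := by linarith
  have hs1 : s⁻¹ ≤ s := (inv_le_one_of_one_le₀ (by linarith)).trans (by linarith)
  have hone : (1 : ℂ) ∈ ann R := mem_ann_of_norm_eq_one hR (by simp)
  have hRinv : 1 / R < 1 := by rw [div_lt_one hR0]; exact hR
  rcases lt_trichotomy ‖c‖ 1 with hlt | heq | hgt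
  · have hψ : DifferentiableOn ℂ (fun z => φ z * z) (ann R) := hφ.mul differentiableOn_id
    have hconst := eqOn_const_of_norm_le_one hR (a := s⁻¹) (b := 1) (c := c)
      ?_ hR hψ ?_ ?_ ?_ hlt ?_
    · refine ⟨φ c * c, ?_, Or.inr fun z hz => ?_⟩
      · rw [← hconst 1 hone]
        simp [h1 1 (by simp)]
      · rw [eq_div_iff (ne_zero_of_mem_ann hR hz)]
        exact hconst z hz
    · rw [one_div]
      exact inv_strictAnti₀ hs0 hsR
    · intro z hz
      have := h3 z ((mem_annK_iff hR).2 ⟨hz.ge, hz.le.trans hs1⟩)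
      rw [norm_mul, hz, ← div_eq_mul_inv]
      exact (div_le_one hs0).2 this
    · intro z hz
      rw [norm_mul, hz, h1 z hz, one_mul]
    · exact (inv_strictAnti₀ (by linarith) hrs).trans_le hcK.1
    · rw [norm_mul]
      calc 1 = r * r⁻¹ := (mul_inv_cancel₀ (by linarith)).symm
        _ ≤ ‖φ c‖ * ‖c‖ := by
          have : 0 ≤ r⁻¹ := by positivity
          gcongr
          exact hcK.1
  · rw [h1 c heq] at hc
    linarith
  · have hψ : DifferentiableOn ℂ (fun z => φ z / z) (ann R) :=
      hφ.div differentiableOn_id fun z hz => ne_zero_of_mem_ann hR hz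
    have hconst := eqOn_const_of_norm_le_one hR (a := 1) (b := s) (c := c)
      hRinv hsR hψ ?_ ?_ hgt ?_ ?_
    · refine ⟨φ c / c, ?_, Or.inl fun z hz => ?_⟩
      · rw [← hconst 1 hone]
        simp [h1 1 (by simp)]
      · rw [← div_eq_iff (ne_zero_of_mem_ann hR hz)]
        exact hconst z hz
    · intro z hz
      rw [norm_div, hz, h1 z hz, div_one]
    · intro z hz
      have := h3 z ((mem_annK_iff hR).2 ⟨hs1.trans hz.ge, hz.le⟩)
      rw [norm_div, hz]
      exact (div_le_one hs0).2 this
    · exact hcK.2.trans_lt hrs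
    · rw [norm_div, one_le_div hcpos]
      exact hcK.2.trans hc

/-- A unital norm-decreasing functional which is unimodular at the identity function is a point
evaluation. The functional is given by its values on affine perturbations of `f`. -/
lemma apply_eq_of_norm_le_on_unitCircle {f : ℂ → ℂ} {ζ a : ℂ}
    (hf : ContinuousOn f (Metric.sphere 0 1)) (hζ : ‖ζ‖ = 1)
    (h : ∀ p q : ℂ, ∃ z ∈ Metric.sphere (0 : ℂ) 1, ‖p + q * ζ + a‖ ≤ ‖p + q * z + f z‖) :
    a = f ζ := by
  have hζζ := conj_mul_self_of_norm_eq_one hζ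
  by_contra hne
  set d := a - f ζ with hd
  have hd0 : 0 < ‖d‖ := norm_pos_iff.2 (sub_ne_zero.2 hne)
  have key : ∀ M : ℕ, ∃ z ∈ Metric.sphere (0 : ℂ) 1,
      (2 * M + 1) * ‖d‖ ≤ M * ‖d‖ * ‖1 + conj ζ * z‖ + ‖f z - f ζ‖ := by
    intro M
    obtain ⟨z, hz, hle⟩ := h (M * d - f ζ) (M * d * conj ζ)
    refine ⟨z, hz, ?_⟩
    have e1 : M * d - f ζ + M * d * conj ζ * ζ + a = (2 * M + 1 : ℕ) * d := by
      rw [mul_assoc, hζζ, hd]; push_cast; ring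
    have e2 : M * d - f ζ + M * d * conj ζ * z + f z
        = M * d * (1 + conj ζ * z) + (f z - f ζ) := by ring
    rw [e1, e2, norm_mul, norm_natCast] at hle
    push_cast at hle
    refine hle.trans ((norm_add_le _ _).trans ?_)
    rw [norm_mul, norm_mul, norm_natCast]
  have hconj : ∀ z ∈ Metric.sphere (0 : ℂ) 1, ‖conj ζ * z‖ ≤ 1 := by
    intro z hz
    rw [mem_sphere_zero_iff_norm] at hz
    rw [norm_mul, norm_conj, hζ, hz, one_mul]
  have htwo : ∀ z ∈ Metric.sphere (0 : ℂ) 1, ‖1 + conj ζ * z‖ ≤ 2 := by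
    intro z hz
    have := norm_add_le 1 (conj ζ * z)
    rw [norm_one] at this
    linarith [hconj z hz]
  have hg : ContinuousOn (fun z => ‖f z - f ζ‖) (Metric.sphere 0 1) :=
    (hf.sub continuousOn_const).norm
  set S : Set ℂ := Metric.sphere 0 1 ∩ (fun z => ‖f z - f ζ‖) ⁻¹' Ici ‖d‖
  have hS : IsCompact S := (isCompact_sphere (0 : ℂ) 1).of_isClosed_subset
    (hg.preimage_isClosed_of_isClosed Metric.isClosed_sphere isClosed_Ici) inter_subset_left
  have keyS : ∀ M : ℕ, ∃ z ∈ S,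
      (2 * M + 1) * ‖d‖ ≤ M * ‖d‖ * ‖1 + conj ζ * z‖ + ‖f z - f ζ‖ := by
    intro M
    obtain ⟨z, hz, hle⟩ := key M
    refine ⟨z, ⟨hz, ?_⟩, hle⟩
    have : M * ‖d‖ * ‖1 + conj ζ * z‖ ≤ M * ‖d‖ * 2 := by
      gcongr
      exact htwo z hz
    simp only [mem_preimage, mem_Ici]
    linarith
  obtain ⟨z₀, hz₀, -⟩ := keyS 0
  obtain ⟨z₁, hz₁, hmax⟩ := hS.exists_isMaxOn ⟨z₀, hz₀⟩
    (f := fun z => ‖1 + conj ζ * z‖) (by fun_prop)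
  have hm : ‖1 + conj ζ * z₁‖ < 2 := by
    by_contra! hcon
    have hz₁ζ := eq_of_conj_mul_eq_one hζ
      (eq_one_of_two_le_norm_one_add (hconj z₁ hz₁.1) hcon)
    have := hz₁.2
    simp only [mem_preimage, mem_Ici, hz₁ζ, sub_self, norm_zero] at this
    linarith
  obtain ⟨C, hC⟩ := ((isCompact_sphere (0 : ℂ) 1).bddAbove_image hg)
  obtain ⟨M, hM⟩ := exists_nat_gt (C / (‖d‖ * (2 - ‖1 + conj ζ * z₁‖)))
  rw [div_lt_iff₀ (mul_pos hd0 (by linarith))] at hM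
  obtain ⟨z, hz, hle⟩ := keyS M
  have h1 : M * ‖d‖ * ‖1 + conj ζ * z‖ ≤ M * ‖d‖ * ‖1 + conj ζ * z₁‖ := by
    gcongr
    exact hmax hz
  have h2 : ‖f z - f ζ‖ ≤ C := hC (mem_image_of_mem _ hz.1)
  nlinarith

/-- The case of an operator fixing the constant function `1`. -/
lemma exists_composition_of_unital {R : ℝ} (hR : 1 < R) {T : (ℂ → ℂ) → ℂ → ℂ}
    (hhol : ∀ f : ℂ → ℂ, DifferentiableOn ℂ f (ann R) → DifferentiableOn ℂ (T f) (ann R))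
    (hadd : ∀ f g : ℂ → ℂ, DifferentiableOn ℂ f (ann R) → DifferentiableOn ℂ g (ann R) →
      ∀ z ∈ ann R, T (f + g) z = T f z + T g z)
    (hsmul : ∀ (c : ℂ) (f : ℂ → ℂ), DifferentiableOn ℂ f (ann R) →
      ∀ z ∈ ann R, T (c • f) z = c * T f z)
    (hle : ∀ f : ℂ → ℂ, DifferentiableOn ℂ f (ann R) → ∀ n : ℕ, 1 ≤ n →
      ∀ w ∈ annK R n, ∃ z ∈ annK R n, ‖T f w‖ ≤ ‖f z‖)
    (hge : ∀ f : ℂ → ℂ, DifferentiableOn ℂ f (ann R) → ∀ n : ℕ, 1 ≤ n →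
      ∀ z ∈ annK R n, ∃ w ∈ annK R n, ‖f z‖ ≤ ‖T f w‖)
    (hone : ∀ z ∈ ann R, T 1 z = 1) :
    ∃ β : ℂ, ‖β‖ = 1 ∧
      ((∀ f : ℂ → ℂ, DifferentiableOn ℂ f (ann R) → ∀ z ∈ ann R, T f z = f (β * z)) ∨
        (∀ f : ℂ → ℂ, DifferentiableOn ℂ f (ann R) → ∀ z ∈ ann R, T f z = f (β / z))) := by
  set φ := T id
  have hid : DifferentiableOn ℂ (id : ℂ → ℂ) (ann R) := differentiableOn_id
  have h1d : DifferentiableOn ℂ (1 : ℂ → ℂ) (ann R) := differentiableOn_const 1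
  have hφ : DifferentiableOn ℂ φ (ann R) := hhol _ hid
  have haff : ∀ (p q : ℂ), ∀ w ∈ ann R, T (p • 1 + q • id) w = p + q * φ w := by
    intro p q w hw
    rw [hadd _ _ (h1d.const_smul p) (hid.const_smul q) w hw, hsmul _ _ h1d w hw,
      hsmul _ _ hid w hw, hone w hw, mul_one]
  have hφ1 : ∀ w : ℂ, ‖w‖ = 1 → ‖φ w‖ ≤ 1 := by
    intro w hw
    obtain ⟨z, hz, hwz⟩ := hle id hid 1 le_rfl w (mem_annK_one.2 hw)
    exact hwz.trans (mem_annK_one.1 hz).le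
  have hsurj : ∀ ζ : ℂ, ‖ζ‖ = 1 → ∃ w, ‖w‖ = 1 ∧ φ w = ζ := by
    intro ζ hζ
    obtain ⟨w, hw, hwle⟩ := hge ((1 : ℂ) • 1 + conj ζ • id)
      ((h1d.const_smul _).add (hid.const_smul _)) 1 le_rfl ζ (mem_annK_one.2 hζ)
    have hw1 := mem_annK_one.1 hw
    rw [haff _ _ w (mem_ann_of_norm_eq_one hR hw1)] at hwle
    refine ⟨w, hw1, eq_of_conj_mul_eq_one hζ (eq_one_of_two_le_norm_one_add ?_ ?_)⟩
    · rw [norm_mul, norm_conj, hζ, one_mul]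
      exact hφ1 w hw1
    · have : ((1 : ℂ) • (1 : ℂ → ℂ) + conj ζ • (id : ℂ → ℂ)) ζ = 2 := by
        simp [conj_mul_self_of_norm_eq_one hζ]; norm_num
      rw [this] at hwle
      simpa using hwle
  have huni : ∀ w : ℂ, ‖w‖ = 1 → ‖φ w‖ = 1 := by
    intro w hw
    refine norm_eq_one_of_infinite hR hφ ?_ hw
    refine Infinite.of_image φ (infinite_unitCircle.mono fun ζ hζ => ?_)
    obtain ⟨w, hw, rfl⟩ := hsurj ζ hζ
    exact ⟨w, ⟨hw, hζ⟩, rfl⟩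
  have heval : ∀ f : ℂ → ℂ, DifferentiableOn ℂ f (ann R) →
      ∀ w : ℂ, ‖w‖ = 1 → T f w = f (φ w) := by
    intro f hf w hw
    have hwA := mem_ann_of_norm_eq_one hR hw
    refine apply_eq_of_norm_le_on_unitCircle
      (hf.continuousOn.mono fun z hz => mem_ann_of_norm_eq_one hR (by simpa using hz))
      (huni w hw) fun p q => ?_
    have hpq := (h1d.const_smul p).add (hid.const_smul q)
    obtain ⟨z, hz, hwz⟩ := hle (p • 1 + q • id + f) (hpq.add hf) 1 le_rfl w (mem_annK_one.2 hw)
    rw [hadd _ _ hpq hf w hwA, haff p q w hwA] at hwz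
    exact ⟨z, by simpa using mem_annK_one.1 hz, by simpa using hwz⟩
  have hβ := exists_eq_mul_or_eq_div hR hφ huni ?_ ?_
  · obtain ⟨β, hβ, h | h⟩ := hβ
    · refine ⟨β, hβ, Or.inl fun f hf z hz => ?_⟩
      refine eqOn_ann_of_eq_unitCircle hR (hhol f hf)
        (g := fun z => f (β * z)) (hf.comp (by fun_prop) fun z hz => ?_) (fun w hw => ?_) hz
      · simpa [ann, hβ] using hz
      · rw [heval f hf w hw, h w (mem_ann_of_norm_eq_one hR hw)]
    · refine ⟨β, hβ, Or.inr fun f hf z hz => ?_⟩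
      refine eqOn_ann_of_eq_unitCircle hR (hhol f hf)
        (g := fun z => f (β / z)) (hf.comp ?_ fun z hz => ?_) (fun w hw => ?_) hz
      · exact (differentiableOn_const β).div hid fun z hz => ne_zero_of_mem_ann hR hz
      · exact div_mem_ann hR hβ hz
      · rw [heval f hf w hw, h w (mem_ann_of_norm_eq_one hR hw)]
  · set r := R ^ (1 - (1 : ℝ) / (2 : ℕ))
    have hr1 : 1 < r := Real.one_lt_rpow hR (by norm_num)
    have hnorm : ‖(r : ℂ)‖ = r := by
      rw [norm_real, Real.norm_of_nonneg (by linarith)]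
    have hrK : (r : ℂ) ∈ annK R 2 := by
      rw [mem_annK_iff hR, hnorm]
      exact ⟨(inv_le_one_of_one_le₀ hr1.le).trans hr1.le, le_rfl⟩
    obtain ⟨w, hw, hwr⟩ := hge id hid 2 (by norm_num) r hrK
    rw [id_eq, hnorm] at hwr
    exact ⟨w, hw, hwr⟩
  · intro w hw
    obtain ⟨z, hz, hwz⟩ := hle id hid 3 (by norm_num) w hw
    exact hwz.trans ((mem_annK_iff hR).1 hz).2

/-- Main theorem: a continuous linear operator on `Hol(𝔸)` that is isometric for all the
seminorms `‖f‖_{∞,n} = sup_{Kₙ} |f|` is of the form `f ↦ α f(β·)` or `f ↦ α f(β/·)` with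
`|α| = |β| = 1`. -/
theorem stmt8 (R : ℝ) (hR : 1 < R) (T : (ℂ → ℂ) → ℂ → ℂ)
    (hhol : ∀ f : ℂ → ℂ, DifferentiableOn ℂ f (ann R) → DifferentiableOn ℂ (T f) (ann R))
    (hadd : ∀ f g : ℂ → ℂ, DifferentiableOn ℂ f (ann R) → DifferentiableOn ℂ g (ann R) →
      ∀ z ∈ ann R, T (f + g) z = T f z + T g z)
    (hsmul : ∀ (c : ℂ) (f : ℂ → ℂ), DifferentiableOn ℂ f (ann R) →
      ∀ z ∈ ann R, T (c • f) z = c * T f z)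
    (hcont : ∀ (F : ℕ → ℂ → ℂ) (f : ℂ → ℂ), (∀ m, DifferentiableOn ℂ (F m) (ann R)) →
      DifferentiableOn ℂ f (ann R) → TendstoLocallyUniformlyOn F f atTop (ann R) →
      TendstoLocallyUniformlyOn (fun m => T (F m)) (T f) atTop (ann R))
    (hiso : ∀ f : ℂ → ℂ, DifferentiableOn ℂ f (ann R) → ∀ n : ℕ, 1 ≤ n →
      sSup ((fun z => ‖T f z‖) '' annK R n) =
        sSup ((fun z => ‖f z‖) '' annK R n)) :
    ∃ α β : ℂ, ‖α‖ = 1 ∧ ‖β‖ = 1 ∧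
      ((∀ f : ℂ → ℂ, DifferentiableOn ℂ f (ann R) → ∀ z ∈ ann R, T f z = α * f (β * z)) ∨
        (∀ f : ℂ → ℂ, DifferentiableOn ℂ f (ann R) → ∀ z ∈ ann R, T f z = α * f (β / z))) := by
  have hle : ∀ f : ℂ → ℂ, DifferentiableOn ℂ f (ann R) → ∀ n : ℕ, 1 ≤ n →
      ∀ w ∈ annK R n, ∃ z ∈ annK R n, ‖T f w‖ ≤ ‖f z‖ := fun f hf n hn w hw =>
    exists_norm_le_of_sSup_eq (isCompact_annK R n)
      ((hhol f hf).continuousOn.mono (annK_subset_ann hR hn))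
      (hf.continuousOn.mono (annK_subset_ann hR hn)) (hiso f hf n hn) hw
  have hge : ∀ f : ℂ → ℂ, DifferentiableOn ℂ f (ann R) → ∀ n : ℕ, 1 ≤ n →
      ∀ z ∈ annK R n, ∃ w ∈ annK R n, ‖f z‖ ≤ ‖T f w‖ := fun f hf n hn z hz =>
    exists_norm_le_of_sSup_eq (isCompact_annK R n)
      (hf.continuousOn.mono (annK_subset_ann hR hn))
      ((hhol f hf).continuousOn.mono (annK_subset_ann hR hn)) (hiso f hf n hn).symm hz
  have h1d : DifferentiableOn ℂ (1 : ℂ → ℂ) (ann R) := differentiableOn_const 1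
  obtain ⟨c, hcK, hc⟩ := hge 1 h1d 1 le_rfl 1 (mem_annK_one.2 (by simp))
  rw [mem_annK_one] at hcK
  simp only [Pi.one_apply, norm_one] at hc
  have hcA : c ∈ ann R := mem_ann_of_norm_eq_one hR hcK
  have hT1 : ∀ n : ℕ, 1 ≤ n → ∀ w ∈ annK R n, ‖T 1 w‖ ≤ 1 := by
    intro n hn w hw
    obtain ⟨z, -, hz⟩ := hle 1 h1d n hn w hw
    simpa using hz
  have hconst : ∀ z ∈ ann R, T 1 z = T 1 c := by
    refine eqOn_const_of_isLocalMax_norm hR (hhol 1 h1d) hcA ?_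
    have hlow : R ^ ((1 : ℝ) / (2 : ℕ) - 1) < ‖c‖ := by
      rw [hcK]
      exact Real.rpow_lt_one_of_one_lt_of_neg hR (by norm_num)
    have hup : ‖c‖ < R ^ (1 - (1 : ℝ) / (2 : ℕ)) := by
      rw [hcK]
      exact Real.one_lt_rpow hR (by norm_num)
    filter_upwards [continuous_norm.continuousAt.eventually (lt_mem_nhds hlow),
      continuous_norm.continuousAt.eventually (gt_mem_nhds hup)] with z h1 h2
    exact (hT1 2 (by norm_num) z ⟨h1.le, h2.le⟩).trans hc
  set α := T 1 c
  have hα : ‖α‖ = 1 := le_antisymm (hT1 1 le_rfl c (mem_annK_one.2 hcK)) hc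
  have hα0 : α ≠ 0 := norm_pos_iff.1 (by rw [hα]; exact one_pos)
  have hnorm : ∀ v : ℂ, ‖α⁻¹ * v‖ = ‖v‖ := fun v => by
    rw [norm_mul, norm_inv, hα, inv_one, one_mul]
  obtain ⟨β, hβ, h⟩ := exists_composition_of_unital hR (T := fun f z => α⁻¹ * T f z)
    (fun f hf => (hhol f hf).const_mul _)
    (fun f g hf hg z hz => by simp only [hadd f g hf hg z hz, mul_add])
    (fun c f hf z hz => by simp only [hsmul c f hf z hz]; ring)
    (by simpa only [hnorm] using hle) (by simpa only [hnorm] using hge)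
    (fun z hz => by simp only [hconst z hz, inv_mul_cancel₀ hα0])
  refine ⟨α, β, hα, hβ, h.imp (fun h f hf z hz => ?_) (fun h f hf z hz => ?_)⟩ <;>
  · rw [← h f hf z hz, mul_inv_cancel_left₀ hα0]
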